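/- Let n and d be positive integers with 2n ≤ d. Then S_d(n,n,n) ⊆ co{ max(0, (6n−2d)/d)·S₂(1), (2n/d)·S₂(1) }. -/

import Mathlib

open Matrix
open scoped Pointwise ComplexOrder

/-- `P` is an orthogonal projection matrix: `P = P† = P²`. -/
def IsProjn {d : ℕ} (P : Matrix (Fin d) (Fin d) ℂ) : Prop :=
  P.IsHermitian ∧ P * P = P

/-- `corrSet d n₁ n₂ n₃` is the set `S_d(n₁,n₂,n₃) ⊆ ℝ³` of triples of normalized
traces of pairwise products of orthogonal projections of the prescribed ranks. -/
def corrSet (d n₁ n₂ n₃ : ℕ) : Set (ℝ × ℝ × ℝ) :=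
  { x | ∃ P₁ P₂ P₃ : Matrix (Fin d) (Fin d) ℂ,
      IsProjn P₁ ∧ IsProjn P₂ ∧ IsProjn P₃ ∧
      P₁.rank = n₁ ∧ P₂.rank = n₂ ∧ P₃.rank = n₃ ∧
      x = ((1 / (d : ℝ)) * ((P₁ * P₂).trace).re,
           (1 / (d : ℝ)) * ((P₁ * P₃).trace).re,
           (1 / (d : ℝ)) * ((P₂ * P₃).trace).re) }

theorem sum_extend_zero {ι κ M : Type*} [Fintype ι] [Fintype κ] [AddCommMonoid M] (e : ι ↪ κ)
    (g : ι → M) : ∑ i, Function.extend e g 0 i = ∑ i, g i := by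
  rw [← Finset.sum_subset (Finset.subset_univ (Finset.univ.map e)), Finset.sum_map]
  · simp [e.injective.extend_apply]
  · intro i _ hi
    rw [Function.extend_apply' _ _ _ (by simpa using hi)]
    rfl

theorem IsCompact.convexHull_of_finiteDimensional {E : Type*} [AddCommGroup E] [Module ℝ E]
    [TopologicalSpace E] [IsTopologicalAddGroup E] [ContinuousSMul ℝ E] [FiniteDimensional ℝ E]
    {s : Set E} (hs : IsCompact s) : IsCompact (convexHull ℝ s) := by
  rcases s.eq_empty_or_nonempty with rfl | ⟨a, ha⟩
  · simp
  set N := Module.finrank ℝ E + 1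
  have hcomp : IsCompact ((fun q : (Fin N → ℝ) × (Fin N → E) => ∑ i, q.1 i • q.2 i) ''
      (stdSimplex ℝ (Fin N) ×ˢ Set.univ.pi fun _ => s)) :=
    ((isCompact_stdSimplex ℝ (Fin N)).prod (isCompact_univ_pi fun _ => hs)).image (by fun_prop)
  convert hcomp
  refine Set.Subset.antisymm (fun x hx => ?_) ?_
  · obtain ⟨ι, _, z, w, hz, hind, hw, hw1, rfl⟩ := eq_pos_convex_span_of_mem_convexHull hx
    obtain ⟨e⟩ := Function.Embedding.nonempty_of_card_le
      (show Fintype.card ι ≤ Fintype.card (Fin N) by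
        simpa [N] using hind.card_le_finrank_succ.trans
          (Nat.succ_le_succ (Submodule.finrank_le _)))
    refine ⟨(Function.extend e w 0, Function.extend e z fun _ => a), ⟨⟨fun i => ?_, ?_⟩, ?_⟩, ?_⟩
    · by_cases hi : ∃ j, e j = i
      · obtain ⟨j, rfl⟩ := hi
        simpa [e.injective.extend_apply] using (hw j).le
      · simp [Function.extend_apply' _ _ _ hi]
    · rw [sum_extend_zero, hw1]
    · intro i _
      by_cases hi : ∃ j, e j = i
      · obtain ⟨j, rfl⟩ := hi
        simpa [e.injective.extend_apply] using hz ⟨j, rfl⟩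
      · simpa [Function.extend_apply' _ _ _ hi] using ha
    · rw [← sum_extend_zero e fun i => w i • z i]
      refine Finset.sum_congr rfl fun i _ => ?_
      by_cases hi : ∃ j, e j = i
      · obtain ⟨j, rfl⟩ := hi
        simp [e.injective.extend_apply]
      · simp [Function.extend_apply' _ _ _ hi]
  · rintro _ ⟨⟨w, z⟩, ⟨⟨hw0, hw1⟩, hz⟩, rfl⟩
    exact (convex_convexHull ℝ s).sum_mem (fun i _ => hw0 i) hw1
      fun i _ => subset_convexHull ℝ s (hz i trivial)

theorem Submodule.exists_between_finrank_eq {K V : Type*} [DivisionRing K] [AddCommGroup V]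
    [Module K V] [FiniteDimensional K V] {A B : Submodule K V} (hAB : A ≤ B) {m : ℕ}
    (hA : Module.finrank K A ≤ m) (hB : m ≤ Module.finrank K B) :
    ∃ C, A ≤ C ∧ C ≤ B ∧ Module.finrank K C = m := by
  induction m, hA using Nat.le_induction with
  | base => exact ⟨A, le_rfl, hAB, rfl⟩
  | succ k _ ih =>
    obtain ⟨C, hAC, hCB, rfl⟩ := ih (by omega)
    obtain ⟨v, hvB, hvC⟩ := SetLike.exists_of_lt
      (lt_of_le_of_ne hCB (by rintro rfl; omega))
    exact ⟨C ⊔ K ∙ v, hAC.trans le_sup_left, sup_le hCB (by simpa using hvB),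
      Submodule.finrank_sup_span_singleton hvC⟩

theorem Matrix.finrank_range_toEuclideanLin {d : ℕ} (P : Matrix (Fin d) (Fin d) ℂ) :
    Module.finrank ℂ (LinearMap.range (toEuclideanLin P)) = P.rank := by
  rw [toEuclideanLin_eq_toLin_orthonormal]
  exact (P.rank_eq_finrank_range_toLin _ _).symm

namespace IsProjn

variable {d : ℕ} {P Q : Matrix (Fin d) (Fin d) ℂ}

theorem exists_range_eq (U : Submodule ℂ (EuclideanSpace ℂ (Fin d))) :
    ∃ P : Matrix (Fin d) (Fin d) ℂ, IsProjn P ∧ LinearMap.range (toEuclideanLin P) = U := by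
  have h := isStarProjection_starProjection (U := U)
  have hinj := EquivLike.injective (toEuclideanCLM (n := Fin d) (𝕜 := ℂ))
  refine ⟨(toEuclideanCLM (n := Fin d) (𝕜 := ℂ)).symm U.starProjection, ⟨hinj ?_, hinj ?_⟩, ?_⟩
  · rw [← star_eq_conjTranspose, map_star, StarAlgEquiv.apply_symm_apply]
    exact h.isSelfAdjoint
  · rw [map_mul, StarAlgEquiv.apply_symm_apply]
    exact h.isIdempotentElem
  rw [← coe_toEuclideanCLM_eq_toEuclideanLin, StarAlgEquiv.apply_symm_apply]
  exact U.range_starProjection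

theorem mul_eq_of_range_le (hP : IsProjn P)
    (h : LinearMap.range (toEuclideanLin Q) ≤ LinearMap.range (toEuclideanLin P)) :
    P * Q = Q := by
  apply toEuclideanLin.injective
  ext1 v
  obtain ⟨w, hw⟩ := h ⟨v, rfl⟩
  rw [toLpLin_mul_same, LinearMap.comp_apply, ← hw, ← LinearMap.comp_apply,
    ← toLpLin_mul_same, hP.2]

theorem trace_eq_rank (hP : IsProjn P) : P.trace = P.rank := by
  have h : IsIdempotentElem (toEuclideanLin P) := by
    rw [IsIdempotentElem, Module.End.mul_eq_comp, ← toLpLin_mul_same, hP.2]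
  rw [← finrank_range_toEuclideanLin, ← (LinearMap.IsIdempotentElem.isProj_range _ h).trace,
    toEuclideanLin_eq_toLin_orthonormal, trace_toLin_eq]

theorem mul_eq_left (hP : IsProjn P) (hQ : IsProjn Q) (h : P * Q = Q) : Q * P = Q := by
  have := congrArg conjTranspose h
  rwa [conjTranspose_mul, hP.1.eq, hQ.1.eq] at this

theorem sub (hP : IsProjn P) (hQ : IsProjn Q) (h : P * Q = Q) : IsProjn (P - Q) :=
  ⟨hP.1.sub hQ.1, by
    rw [sub_mul, mul_sub, mul_sub, hP.2, hQ.2, h, hP.mul_eq_left hQ h, sub_self, sub_zero]⟩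

protected theorem one : IsProjn (1 : Matrix (Fin d) (Fin d) ℂ) := ⟨isHermitian_one, one_mul 1⟩

theorem re_trace_mul_sq_nonneg (hP : IsProjn P) {X : Matrix (Fin d) (Fin d) ℂ}
    (hX : X.IsHermitian) : 0 ≤ (P * (X * X)).trace.re := by
  have h := (posSemidef_conjTranspose_mul_self (X * P)).trace_nonneg
  rw [conjTranspose_mul, hX.eq, hP.1.eq, trace_mul_comm, Matrix.mul_assoc,
    ← Matrix.mul_assoc P P X, hP.2, trace_mul_comm, Matrix.mul_assoc] at h
  exact (Complex.le_def.1 h).1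

theorem re_trace_mul_nonneg (hP : IsProjn P) (hQ : IsProjn Q) : 0 ≤ (P * Q).trace.re := by
  simpa [hQ.2] using hP.re_trace_mul_sq_nonneg hQ.1

theorem re_trace_mul_sq_le (hP : IsProjn P) {X : Matrix (Fin d) (Fin d) ℂ}
    (hX : X.IsHermitian) : (P * (X * X)).trace.re ≤ (X * X).trace.re := by
  have := (IsProjn.one.sub hP (one_mul P)).re_trace_mul_sq_nonneg hX
  rw [sub_mul, trace_sub, one_mul, Complex.sub_re] at this
  linarith

theorem re_trace_mul_le (hP : IsProjn P) (hQ : IsProjn Q) :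
    (P * Q).trace.re ≤ Q.trace.re := by
  simpa [hQ.2] using hP.re_trace_mul_sq_le hQ.1

theorem re_trace_mul_mono {P' Q' : Matrix (Fin d) (Fin d) ℂ} (hP : IsProjn P) (hQ : IsProjn Q)
    (hP' : IsProjn P') (hQ' : IsProjn Q') (h : P * P' = P') (h' : Q * Q' = Q') :
    (P' * Q').trace.re ≤ (P * Q).trace.re := by
  have h₁ := (hP.sub hP' h).re_trace_mul_nonneg hQ
  have h₂ := hP'.re_trace_mul_nonneg (hQ.sub hQ' h')
  rw [sub_mul, trace_sub, Complex.sub_re] at h₁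
  rw [mul_sub, trace_sub, Complex.sub_re] at h₂
  linarith

theorem re_trace_mul_compression_le {E : Matrix (Fin d) (Fin d) ℂ} {m α β τ : ℝ}
    {P₁ : Matrix (Fin d) (Fin d) ℂ} (h₁ : IsProjn P₁) (hP : IsProjn P) (hQ : IsProjn Q)
    (hE : IsProjn E) (hEP : E * P = P) (hEQ : E * Q = Q) (hτ : 0 < τ)
    (tP : P.trace.re = m) (tQ : Q.trace.re = m) (tE : E.trace.re = 2 * m) :
    α * (P₁ * P).trace.re + β * (P₁ * Q).trace.re ≤
      (α + β) / 2 * (P₁ * E).trace.re +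
        (((α + β) ^ 2 / 4 - α * β) * m + α * β * (P * Q).trace.re + m * τ ^ 2) / (2 * τ) := by
  set Y : Matrix (Fin d) (Fin d) ℂ := α • P + β • Q - ((α + β) / 2) • E with hY
  have hPE := hE.mul_eq_left hP hEP
  have hQE := hE.mul_eq_left hQ hEQ
  have hEY : E * Y = Y := by
    simp only [hY, mul_sub, mul_add, mul_smul_comm, hEP, hEQ, hE.2]
  have hYE : Y * E = Y := by
    simp only [hY, sub_mul, add_mul, smul_mul_assoc, hPE, hQE, hE.2]
  have hYh : Y.IsHermitian := by
    simp [hY, IsHermitian, conjTranspose_smul, hP.1.eq, hQ.1.eq, hE.1.eq]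
  have hplus : (Y + τ • E).IsHermitian := by
    simp [IsHermitian, conjTranspose_smul, hYh.eq, hE.1.eq]
  have hminus : (Y - τ • E).IsHermitian := by
    simp [IsHermitian, conjTranspose_smul, hYh.eq, hE.1.eq]
  have eplus : (Y + τ • E) * (Y + τ • E) = Y * Y + (2 * τ) • Y + τ ^ 2 • E := by
    simp only [add_mul, mul_add, smul_mul_assoc, mul_smul_comm, hEY, hYE, hE.2]
    module
  have eminus : (Y - τ • E) * (Y - τ • E) = Y * Y - (2 * τ) • Y + τ ^ 2 • E := by
    simp only [sub_mul, mul_sub, smul_mul_assoc, mul_smul_comm, hEY, hYE, hE.2]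
    module
  have i₁ := h₁.re_trace_mul_sq_le hplus
  have i₂ := h₁.re_trace_mul_sq_nonneg hminus
  have tYY : (Y * Y).trace.re =
      2 * (((α + β) ^ 2 / 4 - α * β) * m + α * β * (P * Q).trace.re) := by
    simp only [hY, sub_mul, mul_sub, add_mul, mul_add, smul_mul_assoc, mul_smul_comm,
      hEP, hEQ, hPE, hQE, hP.2, hQ.2, hE.2, trace_add, trace_sub, trace_smul,
      trace_mul_comm Q P, Complex.add_re, Complex.sub_re, Complex.smul_re, smul_eq_mul,
      tP, tQ, tE]
    ring
  have tY : Y.trace.re = 0 := by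
    simp only [hY, trace_add, trace_sub, trace_smul, Complex.add_re, Complex.sub_re,
      Complex.smul_re, smul_eq_mul, tP, tQ, tE]
    ring
  have t₁Y : (P₁ * Y).trace.re = α * (P₁ * P).trace.re + β * (P₁ * Q).trace.re -
      (α + β) / 2 * (P₁ * E).trace.re := by
    simp only [hY, mul_sub, mul_add, mul_smul_comm, trace_add, trace_sub, trace_smul,
      Complex.add_re, Complex.sub_re, Complex.smul_re, smul_eq_mul]
  simp only [eplus, eminus, mul_sub, mul_add, mul_smul_comm, trace_add, trace_sub, trace_smul,
      Complex.add_re, Complex.sub_re, Complex.smul_re, smul_eq_mul, tY, tYY, tE] at i₁ i₂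
  rw [← sub_le_iff_le_add', ← t₁Y, le_div_iff₀ (by positivity)]
  linarith

end IsProjn

namespace IsProjn

variable {d m : ℕ} {P Q : Matrix (Fin d) (Fin d) ℂ}

theorem exists_majorant (hP : P.rank = m) (hQ : Q.rank = m) (h : 2 * m ≤ d) :
    ∃ E : Matrix (Fin d) (Fin d) ℂ, IsProjn E ∧ E * P = P ∧ E * Q = Q ∧ E.trace.re = 2 * m := by
  have hle := Submodule.finrank_add_le_finrank_add_finrank
    (LinearMap.range (toEuclideanLin P)) (LinearMap.range (toEuclideanLin Q))
  rw [finrank_range_toEuclideanLin, finrank_range_toEuclideanLin, hP, hQ] at hle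
  obtain ⟨W, hW, -, hWm⟩ := Submodule.exists_between_finrank_eq (K := ℂ) (m := 2 * m)
    (A := LinearMap.range (toEuclideanLin P) ⊔ LinearMap.range (toEuclideanLin Q)) (B := ⊤)
    le_top (by omega) (by simpa using h)
  obtain ⟨E, hE, rfl⟩ := exists_range_eq W
  rw [finrank_range_toEuclideanLin] at hWm
  refine ⟨E, hE, hE.mul_eq_of_range_le (le_sup_left.trans hW),
    hE.mul_eq_of_range_le (le_sup_right.trans hW), ?_⟩
  simp [hE.trace_eq_rank, hWm]

theorem exists_le_of_finrank_eq (hP : IsProjn P) (U : Submodule ℂ (EuclideanSpace ℂ (Fin d)))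
    (hU : U ≤ LinearMap.range (toEuclideanLin P)) (hUm : Module.finrank ℂ U = m) :
    ∃ P' : Matrix (Fin d) (Fin d) ℂ, IsProjn P' ∧ P * P' = P' ∧ P'.rank = m ∧
      LinearMap.range (toEuclideanLin P') = U := by
  obtain ⟨P', hP', rfl⟩ := exists_range_eq U
  exact ⟨P', hP', hP.mul_eq_of_range_le hU, by rwa [finrank_range_toEuclideanLin] at hUm, rfl⟩

end IsProjn

theorem Submodule.finrank_prod_eq {K V W : Type*} [Field K] [AddCommGroup V] [Module K V]
    [FiniteDimensional K V] [AddCommGroup W] [Module K W] [FiniteDimensional K W]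
    (A : Submodule K V) (B : Submodule K W) :
    Module.finrank K ↑(A.prod B) = Module.finrank K A + Module.finrank K B := by
  have h : LinearMap.range (A.subtype.prodMap B.subtype) = A.prod B := by
    rw [LinearMap.range_prodMap, A.range_subtype, B.range_subtype]
  rw [← h, LinearMap.finrank_range_of_inj, Module.finrank_prod]
  exact Prod.map_injective.2 ⟨A.subtype_injective, B.subtype_injective⟩

theorem Submodule.exists_finrank_sup_le {K V : Type*} [Field K] [AddCommGroup V]
    [Module K V] [FiniteDimensional K V] {n m : ℕ} (U₁ U₂ U₃ : Submodule K V)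
    (h₁ : Module.finrank K U₁ = n) (h₂ : Module.finrank K U₂ = n) (h₃ : Module.finrank K U₃ = n)
    (hm : m + Module.finrank K V = 3 * n) (hmn : m ≤ n) :
    ∃ W₁ W₂ W₃ : Submodule K V, W₁ ≤ U₁ ∧ W₂ ≤ U₂ ∧ W₃ ≤ U₃ ∧ Module.finrank K W₁ = m ∧
      Module.finrank K W₂ = m ∧ Module.finrank K W₃ = m ∧
      Module.finrank K ↑(W₁ ⊔ W₂ ⊔ W₃) ≤ 2 * m := by
  let σ : V × V × V →ₗ[K] V :=
    LinearMap.coprod LinearMap.id (LinearMap.coprod LinearMap.id LinearMap.id)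
  have rank_nullity (A₁ A₂ A₃ : Submodule K V) :
      Module.finrank K ↑(A₁ ⊔ A₂ ⊔ A₃) +
        Module.finrank K ↑(A₁.prod (A₂.prod A₃) ⊓ LinearMap.ker σ) =
      Module.finrank K A₁ + Module.finrank K A₂ + Module.finrank K A₃ := by
    have hr := LinearMap.finrank_range_add_finrank_ker (σ.domRestrict (A₁.prod (A₂.prod A₃)))
    have e₁ : LinearMap.range (σ.domRestrict (A₁.prod (A₂.prod A₃))) = A₁ ⊔ A₂ ⊔ A₃ := by
      rw [LinearMap.range_domRestrict, LinearMap.map_coprod_prod, LinearMap.map_coprod_prod,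
        Submodule.map_id, Submodule.map_id, Submodule.map_id, sup_assoc]
    have e₂ : (LinearMap.ker (σ.domRestrict (A₁.prod (A₂.prod A₃)))).map
        (A₁.prod (A₂.prod A₃)).subtype = A₁.prod (A₂.prod A₃) ⊓ LinearMap.ker σ := by
      rw [LinearMap.ker_domRestrict, Submodule.map_comap_subtype]
    rw [e₁, ← Submodule.finrank_map_subtype_eq, e₂, finrank_prod_eq, finrank_prod_eq] at hr
    omega
  have hker := rank_nullity U₁ U₂ U₃
  have hle := Submodule.finrank_le (U₁ ⊔ U₂ ⊔ U₃)
  obtain ⟨N, -, hN, hNm⟩ := Submodule.exists_between_finrank_eq (K := K) (m := m)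
    (A := ⊥) (B := U₁.prod (U₂.prod U₃) ⊓ LinearMap.ker σ) bot_le (by simp) (by omega)
  have component (U : Submodule K V) (π : V × V × V →ₗ[K] V) (hU : Module.finrank K U = n)
      (hπ : N.map π ≤ U) : ∃ W, N.map π ≤ W ∧ W ≤ U ∧ Module.finrank K W = m :=
    Submodule.exists_between_finrank_eq hπ (hNm ▸ Submodule.finrank_map_le π N) (hU ▸ hmn)
  obtain ⟨W₁, hN₁, hW₁, hr₁⟩ := component U₁ (LinearMap.fst K V (V × V)) h₁ (by
    rintro _ ⟨x, hx, rfl⟩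
    exact (hN hx).1.1)
  obtain ⟨W₂, hN₂, hW₂, hr₂⟩ := component U₂ (LinearMap.fst K V V ∘ₗ LinearMap.snd K V (V × V)) h₂
    (by
      rintro _ ⟨x, hx, rfl⟩
      exact (hN hx).1.2.1)
  obtain ⟨W₃, hN₃, hW₃, hr₃⟩ := component U₃ (LinearMap.snd K V V ∘ₗ LinearMap.snd K V (V × V)) h₃
    (by
      rintro _ ⟨x, hx, rfl⟩
      exact (hN hx).1.2.2)
  refine ⟨W₁, W₂, W₃, hW₁, hW₂, hW₃, hr₁, hr₂, hr₃, ?_⟩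
  have hle : N ≤ W₁.prod (W₂.prod W₃) ⊓ LinearMap.ker σ := fun x hx =>
    ⟨⟨hN₁ ⟨x, hx, rfl⟩, hN₂ ⟨x, hx, rfl⟩, hN₃ ⟨x, hx, rfl⟩⟩, (hN hx).2⟩
  have := Submodule.finrank_mono hle
  have := rank_nullity W₁ W₂ W₃
  omega

namespace IsProjn

variable {d n m : ℕ} {P₁ P₂ P₃ : Matrix (Fin d) (Fin d) ℂ}

theorem exists_compression (h₁ : IsProjn P₁) (h₂ : IsProjn P₂) (h₃ : IsProjn P₃)
    (r₁ : P₁.rank = n) (r₂ : P₂.rank = n) (r₃ : P₃.rank = n) (hm : m + d = 3 * n)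
    (hn : 2 * n ≤ d) :
    ∃ P₁' P₂' P₃' E : Matrix (Fin d) (Fin d) ℂ, IsProjn P₁' ∧ IsProjn P₂' ∧ IsProjn P₃' ∧
      IsProjn E ∧ P₁ * P₁' = P₁' ∧ P₂ * P₂' = P₂' ∧ P₃ * P₃' = P₃' ∧ E * P₁' = P₁' ∧
      E * P₂' = P₂' ∧ E * P₃' = P₃' ∧ P₁'.rank = m ∧ P₂'.rank = m ∧ P₃'.rank = m ∧
      E.trace.re = 2 * m := by
  obtain ⟨W₁, W₂, W₃, hW₁, hW₂, hW₃, hr₁, hr₂, hr₃, hle⟩ :=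
    Submodule.exists_finrank_sup_le (LinearMap.range (toEuclideanLin P₁))
      (LinearMap.range (toEuclideanLin P₂)) (LinearMap.range (toEuclideanLin P₃))
      (n := n) (m := m) (by rwa [finrank_range_toEuclideanLin])
      (by rwa [finrank_range_toEuclideanLin]) (by rwa [finrank_range_toEuclideanLin])
      (by simpa using hm) (by omega)
  obtain ⟨W, hW, -, hWm⟩ := Submodule.exists_between_finrank_eq (K := ℂ) (m := 2 * m)
    (le_top : W₁ ⊔ W₂ ⊔ W₃ ≤ ⊤) hle (by simp; omega)
  obtain ⟨E, hE, rfl⟩ := exists_range_eq W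
  obtain ⟨P₁', h₁', hP₁, r₁', rfl⟩ := h₁.exists_le_of_finrank_eq W₁ hW₁ hr₁
  obtain ⟨P₂', h₂', hP₂, r₂', rfl⟩ := h₂.exists_le_of_finrank_eq W₂ hW₂ hr₂
  obtain ⟨P₃', h₃', hP₃, r₃', rfl⟩ := h₃.exists_le_of_finrank_eq W₃ hW₃ hr₃
  rw [finrank_range_toEuclideanLin] at hWm
  simp only [sup_le_iff] at hW
  exact ⟨P₁', P₂', P₃', E, h₁', h₂', h₃', hE, hP₁, hP₂, hP₃, hE.mul_eq_of_range_le hW.1.1,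
    hE.mul_eq_of_range_le hW.1.2, hE.mul_eq_of_range_le hW.2, r₁', r₂', r₃',
    by simp [hE.trace_eq_rank, hWm]⟩

end IsProjn

/-- The trace of the product of the real qubit projections with Bloch vectors `u` and `v`. -/
noncomputable def blochOverlap (u v : Circle) : ℝ :=
  (1 + ((u : ℂ).re * (v : ℂ).re + (u : ℂ).im * (v : ℂ).im)) / 2

/-- The rank-one projection on `ℂ²` with Bloch vector `u` on the real great circle. -/
noncomputable def blochProjn (u : Circle) : Matrix (Fin 2) (Fin 2) ℂ :=
  !![(((1 + (u : ℂ).re) / 2 : ℝ) : ℂ), (((u : ℂ).im / 2 : ℝ) : ℂ);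
    (((u : ℂ).im / 2 : ℝ) : ℂ), (((1 - (u : ℂ).re) / 2 : ℝ) : ℂ)]

theorem Circle.re_sq_add_im_sq (u : Circle) : (u : ℂ).re ^ 2 + (u : ℂ).im ^ 2 = 1 := by
  have := u.normSq_coe
  rw [Complex.normSq_apply] at this
  linarith

theorem blochOverlap_comm (u v : Circle) : blochOverlap u v = blochOverlap v u := by
  unfold blochOverlap
  ring

theorem blochOverlap_self (u : Circle) : blochOverlap u u = 1 := by
  unfold blochOverlap
  linarith [u.re_sq_add_im_sq]

theorem continuous_blochOverlap : Continuous fun p : Circle × Circle => blochOverlap p.1 p.2 := by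
  unfold blochOverlap
  fun_prop

theorem isProjn_blochProjn (u : Circle) : IsProjn (blochProjn u) := by
  have h := u.re_sq_add_im_sq
  refine ⟨?_, ?_⟩
  · ext i j
    fin_cases i <;> fin_cases j <;> simp [blochProjn, conjTranspose_apply]
  · rw [blochProjn, mul_fin_two]
    simp only [← Complex.ofReal_mul, ← Complex.ofReal_add]
    ext i j
    fin_cases i <;> fin_cases j <;> refine congrArg Complex.ofReal ?_ <;> linarith

theorem rank_blochProjn (u : Circle) : (blochProjn u).rank = 1 := by
  have h := (isProjn_blochProjn u).trace_eq_rank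
  rw [blochProjn, trace_fin_two_of, ← blochProjn, ← Complex.ofReal_add] at h
  have : (((blochProjn u).rank : ℝ) : ℂ) = ((1 : ℝ) : ℂ) := by
    rw [Complex.ofReal_natCast, ← h]
    congr 1
    ring
  exact_mod_cast this

theorem re_trace_blochProjn_mul (u v : Circle) :
    (blochProjn u * blochProjn v).trace.re = blochOverlap u v := by
  rw [blochProjn, blochProjn, mul_fin_two, trace_fin_two_of]
  simp only [← Complex.ofReal_mul, ← Complex.ofReal_add, Complex.ofReal_re, blochOverlap]
  ring

theorem blochOverlap_mem_corrSet (u v w : Circle) :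
    (blochOverlap u v / 2, blochOverlap u w / 2, blochOverlap v w / 2) ∈ corrSet 2 1 1 1 := by
  refine ⟨blochProjn u, blochProjn v, blochProjn w, isProjn_blochProjn u, isProjn_blochProjn v,
    isProjn_blochProjn w, rank_blochProjn u, rank_blochProjn v, rank_blochProjn w, ?_⟩
  simp only [re_trace_blochProjn_mul]
  push_cast
  ring_nf

theorem exists_circle_overlaps (α β : ℝ) {x : ℝ} (h₀ : 0 ≤ x) (h₁ : x ≤ 1) :
    ∃ (u v w : Circle) (r : ℝ), 0 ≤ r ∧ r ^ 2 = (α + β) ^ 2 / 4 - α * β * (1 - x) ∧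
      blochOverlap v w = x ∧
      α * blochOverlap u v + β * blochOverlap u w = (α + β) / 2 + r := by
  set w := Circle.exp (Real.arccos (2 * x - 1))
  have hre : (w : ℂ).re = 2 * x - 1 := by
    rw [Circle.coe_exp, Complex.exp_ofReal_mul_I_re,
      Real.cos_arccos (by linarith) (by linarith)]
  have hw := w.re_sq_add_im_sq
  set a : ℂ := α + β * w with ha
  have are : a.re = α + β * (w : ℂ).re := by simp [ha]
  have aim : a.im = β * (w : ℂ).im := by simp [ha]
  refine ⟨Circle.exp a.arg, 1, w, ‖a‖ / 2, by positivity, ?_, ?_, ?_⟩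
  · rw [div_pow, Complex.sq_norm, Complex.normSq_apply, are, aim]
    rw [hre] at hw ⊢
    linear_combination β ^ 2 / 4 * hw
  · simp [blochOverlap, hre]
  · have h₁ := Complex.norm_mul_cos_arg a
    have h₂ := Complex.norm_mul_sin_arg a
    simp only [blochOverlap, Circle.coe_exp, Complex.exp_ofReal_mul_I_re,
      Complex.exp_ofReal_mul_I_im, Circle.coe_one, Complex.one_re, Complex.one_im]
    have h₃ := Real.cos_sq_add_sin_sq a.arg
    rw [are] at h₁
    rw [aim] at h₂
    linear_combination ‖a‖ / 2 * h₃ - Real.cos a.arg / 2 * h₁ - Real.sin a.arg / 2 * h₂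

namespace IsProjn

variable {d n m : ℕ} {P Q P₁ P₂ P₃ E : Matrix (Fin d) (Fin d) ℂ}

theorem re_trace_eq (hP : IsProjn P) (hr : P.rank = m) : P.trace.re = m := by
  simp [hP.trace_eq_rank, hr]

theorem exists_blochOverlap_ge (hm : 0 < m) (h₁ : IsProjn P₁) (hP : IsProjn P) (hQ : IsProjn Q)
    (hE : IsProjn E) (hEP : E * P = P) (hEQ : E * Q = Q) (rP : P.rank = m) (rQ : Q.rank = m)
    (tE : E.trace.re = 2 * m) {α β : ℝ} (γ : ℝ)
    (hs : (α + β) / 2 * (P₁ * E).trace.re ≤ (α + β) / 2 * m) :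
    ∃ u v w : Circle,
      α * (P₁ * P).trace.re + β * (P₁ * Q).trace.re + γ * (P * Q).trace.re ≤
        m * (α * blochOverlap u v + β * blochOverlap u w + γ * blochOverlap v w) := by
  have hm' : (0 : ℝ) < m := Nat.cast_pos.2 hm
  have hle := hP.re_trace_mul_le hQ
  rw [hQ.re_trace_eq rQ] at hle
  obtain ⟨u, v, w, r, hr, hr2, hx, huv⟩ := exists_circle_overlaps α β
    (div_nonneg (hP.re_trace_mul_nonneg hQ) hm'.le) ((div_le_one hm').2 hle)
  refine ⟨u, v, w, ?_⟩
  have hγ : γ * (P * Q).trace.re = m * (γ * blochOverlap v w) := by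
    rw [hx]
    field_simp
  have hR : ((α + β) ^ 2 / 4 - α * β) * m + α * β * (P * Q).trace.re = m * r ^ 2 := by
    rw [hr2]
    field_simp
    ring
  have bound {τ : ℝ} (hτ : 0 < τ) := re_trace_mul_compression_le (α := α) (β := β) h₁ hP hQ hE hEP
    hEQ hτ (hP.re_trace_eq rP) (hQ.re_trace_eq rQ) tE
  rw [hR] at bound
  suffices α * (P₁ * P).trace.re + β * (P₁ * Q).trace.re ≤ m * ((α + β) / 2 + r) by
    rw [hγ, huv, mul_add]
    linarith
  rcases hr.eq_or_lt with rfl | hr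
  · refine le_of_forall_pos_le_add fun ε hε => ?_
    have h := bound (τ := 2 * ε / m) (by positivity)
    have : (m * (0 : ℝ) ^ 2 + m * (2 * ε / m) ^ 2) / (2 * (2 * ε / m)) = ε := by
      field_simp
      ring
    linarith
  · have h := bound hr
    have : (m * r ^ 2 + m * r ^ 2) / (2 * r) = m * r := by
      field_simp
      ring
    linarith

theorem exists_blochOverlap_ge_of_add_nonneg (hn : 0 < n) (hd : 2 * n ≤ d) (h₁ : IsProjn P₁)
    (h₂ : IsProjn P₂) (h₃ : IsProjn P₃) (r₁ : P₁.rank = n) (r₂ : P₂.rank = n)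
    (r₃ : P₃.rank = n) {α β : ℝ} (γ : ℝ) (hs : 0 ≤ α + β) :
    ∃ u v w : Circle,
      α * (P₁ * P₂).trace.re + β * (P₁ * P₃).trace.re + γ * (P₂ * P₃).trace.re ≤
        n * (α * blochOverlap u v + β * blochOverlap u w + γ * blochOverlap v w) := by
  obtain ⟨E, hE, hE₂, hE₃, tE⟩ := exists_majorant r₂ r₃ hd
  refine exists_blochOverlap_ge hn h₁ h₂ h₃ hE hE₂ hE₃ r₂ r₃ tE γ ?_
  have := hE.re_trace_mul_le h₁
  rw [h₁.re_trace_eq r₁, trace_mul_comm] at this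
  gcongr

theorem exists_blochOverlap_ge_or_nonpos (hn : 0 < n) (hd : 2 * n ≤ d) (h₁ : IsProjn P₁)
    (h₂ : IsProjn P₂) (h₃ : IsProjn P₃) (r₁ : P₁.rank = n) (r₂ : P₂.rank = n)
    (r₃ : P₃.rank = n) (α β γ : ℝ) :
    (α ≤ 0 ∧ β ≤ 0 ∧ γ ≤ 0) ∨ ∃ u v w : Circle,
      α * (P₁ * P₂).trace.re + β * (P₁ * P₃).trace.re + γ * (P₂ * P₃).trace.re ≤
        n * (α * blochOverlap u v + β * blochOverlap u w + γ * blochOverlap v w) := by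
  by_cases hα : 0 ≤ α + β
  · exact .inr (exists_blochOverlap_ge_of_add_nonneg hn hd h₁ h₂ h₃ r₁ r₂ r₃ γ hα)
  by_cases hβ : 0 ≤ α + γ
  · obtain ⟨u, v, w, h⟩ := exists_blochOverlap_ge_of_add_nonneg hn hd h₂ h₁ h₃ r₂ r₁ r₃ β hβ
    refine .inr ⟨v, u, w, ?_⟩
    rw [trace_mul_comm P₂ P₁, blochOverlap_comm u v] at h
    linarith
  by_cases hγ : 0 ≤ β + γ
  · obtain ⟨u, v, w, h⟩ := exists_blochOverlap_ge_of_add_nonneg hn hd h₃ h₁ h₂ r₃ r₁ r₂ α hγ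
    refine .inr ⟨v, w, u, ?_⟩
    rw [trace_mul_comm P₃ P₁, trace_mul_comm P₃ P₂, blochOverlap_comm u v,
      blochOverlap_comm u w] at h
    linarith
  obtain ⟨v, hv⟩ : ∃ v : Circle, blochOverlap 1 v = 0 := by
    refine ⟨Circle.exp Real.pi, ?_⟩
    simp [blochOverlap, Circle.coe_exp]
  have p₁₂ := h₁.re_trace_mul_nonneg h₂
  have p₁₃ := h₁.re_trace_mul_nonneg h₃
  have p₂₃ := h₂.re_trace_mul_nonneg h₃
  have q₁₂ := h₁.re_trace_mul_le h₂
  have q₁₃ := h₁.re_trace_mul_le h₃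
  have q₂₃ := h₂.re_trace_mul_le h₃
  rw [h₂.re_trace_eq r₂] at q₁₂
  rw [h₃.re_trace_eq r₃] at q₁₃ q₂₃
  by_cases α_pos : 0 < α
  · refine .inr ⟨1, 1, v, ?_⟩
    rw [blochOverlap_self, hv]
    nlinarith
  by_cases β_pos : 0 < β
  · refine .inr ⟨1, v, 1, ?_⟩
    rw [blochOverlap_self, blochOverlap_comm v, hv]
    nlinarith
  by_cases γ_pos : 0 < γ
  · refine .inr ⟨v, 1, 1, ?_⟩
    rw [blochOverlap_self, blochOverlap_comm v, hv]
    nlinarith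
  exact .inl ⟨by linarith, by linarith, by linarith⟩

theorem exists_blochOverlap_ge_of_nonpos (hd : 2 * n ≤ d) (h₁ : IsProjn P₁)
    (h₂ : IsProjn P₂) (h₃ : IsProjn P₃) (r₁ : P₁.rank = n) (r₂ : P₂.rank = n)
    (r₃ : P₃.rank = n) {α β γ : ℝ} (hα : α ≤ 0) (hβ : β ≤ 0) (hγ : γ ≤ 0) :
    ∃ u v w : Circle,
      α * (P₁ * P₂).trace.re + β * (P₁ * P₃).trace.re + γ * (P₂ * P₃).trace.re ≤
        max 0 (3 * n - d : ℝ) *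
          (α * blochOverlap u v + β * blochOverlap u w + γ * blochOverlap v w) := by
  rcases le_or_gt (3 * n) d with hle | hlt
  · have hle' : (3 * n - d : ℝ) ≤ 0 := sub_nonpos.2 (by exact_mod_cast hle)
    refine ⟨1, 1, 1, ?_⟩
    rw [max_eq_left hle', zero_mul]
    nlinarith [h₁.re_trace_mul_nonneg h₂, h₁.re_trace_mul_nonneg h₃, h₂.re_trace_mul_nonneg h₃]
  · obtain ⟨m, hm⟩ := Nat.exists_eq_add_of_lt hlt
    have hmd : (3 * n - d : ℝ) = (m + 1 : ℕ) := by
      rw [sub_eq_iff_eq_add]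
      exact_mod_cast (by omega : 3 * n = m + 1 + d)
    obtain ⟨P₁', P₂', P₃', E, h₁', h₂', h₃', hE, e₁, e₂, e₃, hE₁, hE₂, hE₃, r₁', r₂', r₃', tE⟩ :=
      exists_compression (m := m + 1) h₁ h₂ h₃ r₁ r₂ r₃ (by omega) hd
    rw [hmd, max_eq_right (Nat.cast_nonneg _)]
    obtain ⟨u, v, w, h⟩ := exists_blochOverlap_ge (α := α) (β := β) m.succ_pos h₁' h₂' h₃' hE hE₂
      hE₃ r₂' r₃' tE γ (by rw [hE.mul_eq_left h₁' hE₁, h₁'.re_trace_eq r₁'])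
    refine ⟨u, v, w, le_trans ?_ h⟩
    have := mul_le_mul_of_nonpos_left (h₁.re_trace_mul_mono h₂ h₁' h₂' e₁ e₂) hα
    have := mul_le_mul_of_nonpos_left (h₁.re_trace_mul_mono h₃ h₁' h₃' e₁ e₃) hβ
    have := mul_le_mul_of_nonpos_left (h₂.re_trace_mul_mono h₃ h₂' h₃' e₂ e₃) hγ
    linarith

end IsProjn

/-- Proposition 3.7 (type I slices from above): if `2n ≤ d`, then
`S_d(n,n,n) ⊆ co(max(0,(6n−2d)/d)·S₂(1) ∪ (2n/d)·S₂(1))`. -/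
theorem corrSet_typeI (n d : ℕ) (hn : 0 < n) (hd : 0 < d) (h : 2 * n ≤ d) :
    corrSet d n n n ⊆
      convexHull ℝ
        ((max 0 ((6 * (n : ℝ) - 2 * (d : ℝ)) / (d : ℝ))) • corrSet 2 1 1 1 ∪
          ((2 * (n : ℝ)) / (d : ℝ)) • corrSet 2 1 1 1) := by
  rintro _ ⟨P₁, P₂, P₃, h₁, h₂, h₃, r₁, r₂, r₃, rfl⟩
  have hd' : (0 : ℝ) < d := Nat.cast_pos.2 hd
  let K : Set (ℝ × ℝ × ℝ) := Set.range fun p : Circle × Circle × Circle =>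
    (blochOverlap p.1 p.2.1 / 2, blochOverlap p.1 p.2.2 / 2, blochOverlap p.2.1 p.2.2 / 2)
  have hK : IsCompact K := by
    refine isCompact_range ?_
    have h := continuous_blochOverlap
    exact ((h.comp (by fun_prop : Continuous fun p : Circle × Circle × Circle =>
        (p.1, p.2.1))).div_const 2).prodMk
      (((h.comp (by fun_prop : Continuous fun p : Circle × Circle × Circle =>
        (p.1, p.2.2))).div_const 2).prodMk ((h.comp continuous_snd).div_const 2))
  have hKS : K ⊆ corrSet 2 1 1 1 := by
    rintro _ ⟨⟨u, v, w⟩, rfl⟩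
    exact blochOverlap_mem_corrSet u v w
  refine convexHull_mono (Set.union_subset_union (Set.smul_set_mono hKS)
    (Set.smul_set_mono hKS)) ?_
  by_contra hx
  obtain ⟨f, t, hf, ht⟩ := geometric_hahn_banach_closed_point (convex_convexHull ℝ _)
    ((hK.smul _).union (hK.smul _)).convexHull_of_finiteDimensional.isClosed hx
  obtain ⟨α, β, γ, hfe⟩ : ∃ α β γ : ℝ, ∀ x y z, f (x, y, z) = α * x + β * y + γ * z := by
    refine ⟨f (1, 0, 0), f (0, 1, 0), f (0, 0, 1), fun x y z => ?_⟩
    have : ((x, y, z) : ℝ × ℝ × ℝ) = x • (1, 0, 0) + y • (0, 1, 0) + z • (0, 0, 1) := by simp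
    rw [this, map_add, map_add, map_smul, map_smul, map_smul]
    simp only [smul_eq_mul, mul_comm]
  rw [hfe] at ht
  have key {c : ℝ} {u v w : Circle}
      (hc : ((2 * c) / d) • ((blochOverlap u v / 2, blochOverlap u w / 2, blochOverlap v w / 2) :
        ℝ × ℝ × ℝ) ∈ (max 0 ((6 * (n : ℝ) - 2 * (d : ℝ)) / (d : ℝ))) • K ∪
          ((2 * (n : ℝ)) / (d : ℝ)) • K) :
      c * (α * blochOverlap u v + β * blochOverlap u w + γ * blochOverlap v w) <
        α * (P₁ * P₂).trace.re + β * (P₁ * P₃).trace.re + γ * (P₂ * P₃).trace.re := by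
    have h := (hf _ (subset_convexHull ℝ _ hc)).trans ht
    rw [map_smul, hfe, smul_eq_mul] at h
    rw [← mul_lt_mul_iff_of_pos_left (one_div_pos.2 hd')]
    convert h using 1 <;> ring
  rcases IsProjn.exists_blochOverlap_ge_or_nonpos hn h h₁ h₂ h₃ r₁ r₂ r₃ α β γ with
    ⟨hα, hβ, hγ⟩ | ⟨u, v, w, huvw⟩
  · obtain ⟨u, v, w, huvw⟩ :=
      IsProjn.exists_blochOverlap_ge_of_nonpos h h₁ h₂ h₃ r₁ r₂ r₃ hα hβ hγ
    refine (key (Or.inl ?_)).not_ge huvw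
    have hmax : max 0 ((6 * (n : ℝ) - 2 * (d : ℝ)) / (d : ℝ)) =
        2 * max 0 (3 * n - d : ℝ) / d := by
      rw [mul_max_of_nonneg _ _ zero_le_two, ← max_div_div_right hd'.le, mul_zero, zero_div]
      ring_nf
    rw [hmax]
    exact Set.smul_mem_smul_set ⟨(u, v, w), rfl⟩
  · exact (key (Or.inr (Set.smul_mem_smul_set ⟨(u, v, w), rfl⟩))).not_ge huvw
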